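/- There exists a constant c > 0, depending only on λ = sup_k m_k, such that for every martingale f ∈ H_1 the logarithmically weighted maximal operator of partial sums satisfies ‖ sup_{n≥1} |S_n f| / log(n+1) ‖_{L_1(μ)} ≤ c · ‖f‖_{H_1}. -/

import Mathlib

open MeasureTheory Complex Finset
open scoped BigOperators ENNReal NNReal

noncomputable section

instance (n : ℕ) : MeasurableSpace (ZMod n) := ⊤

/-- The Vilenkin group determined by the generating sequence `m`. -/
abbrev Gm (m : ℕ → ℕ) : Type := ∀ _k : ℕ, ZMod (m _k)

namespace Vilenkin

variable (m : ℕ → ℕ)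

/-- The generalized powers `M_0 = 1`, `M_{k+1} = m_k · M_k`. -/
def M : ℕ → ℕ
  | 0 => 1
  | k + 1 => m k * M k

/-- The `j`-th digit `n_j` of `n` in the generalized number system based on `m`. -/
def digit (n j : ℕ) : ℕ := n / M m j % m j

/-- `|n|`, the index of the highest nonzero digit of `n`. -/
def hi (n : ℕ) : ℕ := Nat.findGreatest (fun j => digit m n j ≠ 0) n

/-- `⟨n⟩`, the index of the lowest nonzero digit of `n`. -/
def lo (n : ℕ) : ℕ := sInf {j | digit m n j ≠ 0}

/-- The generalized Rademacher functions `r_k(x) = exp(2πi x_k / m_k)`. -/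
def rad (k : ℕ) (x : Gm m) : ℂ :=
  Complex.exp (2 * Real.pi * Complex.I * ((x k).val : ℂ) / (m k : ℂ))

/-- The Vilenkin functions `ψ_n = ∏_k r_k^{n_k}`. -/
def vil (n : ℕ) (x : Gm m) : ℂ :=
  ∏ k ∈ Finset.range (n + 1), rad m k x ^ digit m n k

/-- The Dirichlet kernels `D_n = ∑_{k=0}^{n-1} ψ_k`. -/
def D (n : ℕ) (x : Gm m) : ℂ := ∑ k ∈ Finset.range n, vil m k x

/-- The Fejér kernels `K_n = (1/n) ∑_{k=1}^{n} D_k`. -/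
def K (n : ℕ) (x : Gm m) : ℂ := (n : ℂ)⁻¹ * ∑ k ∈ Finset.range n, D m (k + 1) x

/-- The Nörlund kernels `F_n = (1/Q_n) ∑_{k=1}^{n} q_{n-k} D_k` where
`Q_n = ∑_{k=0}^{n-1} q_k`. -/
def FK (q : ℕ → ℝ) (n : ℕ) (x : Gm m) : ℂ :=
  ((∑ k ∈ Finset.range n, q k : ℝ) : ℂ)⁻¹ *
    ∑ k ∈ Finset.range n, (q (n - (k + 1)) : ℂ) * D m (k + 1) x

/-- The cylinder subgroup `I_n = {x : x_0 = … = x_{n-1} = 0}`. -/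
def I (n : ℕ) : Set (Gm m) := {x | ∀ k < n, x k = 0}

/-- The cylinder of length `n` around `x`. -/
def cylAt (n : ℕ) (x : Gm m) : Set (Gm m) := {y | ∀ k < n, y k = x k}

/-- `μ` is the normalized Haar measure of `G_m`: the (unique) Borel probability
measure giving each cylinder of length `n` measure `1 / M_n`. -/
def IsHaar (μ : Measure (Gm m)) : Prop :=
  ∀ (n : ℕ) (x : Gm m), μ (cylAt m n x) = (M m n : ℝ≥0∞)⁻¹

/-- A martingale with respect to the filtration `(ℱ_n)` on `G_m`, where `ℱ_n` is
generated by the first `n` coordinates: each `f n` is integrable and depends only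
on the first `n` coordinates, and the conditional expectation of `f N` with
respect to `ℱ_n` (which under the Haar measure is given by averaging over the
cylinders of length `n`) equals `f n` for `n ≤ N`. -/
structure IsMartingale (μ : Measure (Gm m)) (f : ℕ → Gm m → ℂ) : Prop where
  integrable : ∀ n, Integrable (f n) μ
  adapted : ∀ (n : ℕ) (x y : Gm m), (∀ k < n, x k = y k) → f n x = f n y
  mart : ∀ n N : ℕ, n ≤ N → ∀ x : Gm m,
    f n x = (M m n : ℂ) * ∫ t in cylAt m n x, f N t ∂μ

/-- The Vilenkin–Fourier coefficients of a martingale: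
`f̂(i) = lim_k ∫ f^(k) conj(ψ_i) dμ`; for a martingale these integrals are
constant as soon as `M_k > i`, in particular from `k = i + 1` on. -/
def coeff (μ : Measure (Gm m)) (f : ℕ → Gm m → ℂ) (i : ℕ) : ℂ :=
  ∫ x, f (i + 1) x * (starRingEnd ℂ) (vil m i x) ∂μ

/-- The partial sums `S_n f = ∑_{k=0}^{n-1} f̂(k) ψ_k`. -/
def S (μ : Measure (Gm m)) (f : ℕ → Gm m → ℂ) (n : ℕ) (x : Gm m) : ℂ :=
  ∑ k ∈ Finset.range n, coeff m μ f k * vil m k x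

/-- The Fejér means `σ_n f = (1/n) ∑_{k=1}^{n} S_k f`. -/
def sigma (μ : Measure (Gm m)) (f : ℕ → Gm m → ℂ) (n : ℕ) (x : Gm m) : ℂ :=
  (n : ℂ)⁻¹ * ∑ k ∈ Finset.range n, S m μ f (k + 1) x

/-- The Nörlund means `t_n f = (1/Q_n) ∑_{k=1}^{n} q_{n-k} S_k f`. -/
def T (μ : Measure (Gm m)) (q : ℕ → ℝ) (f : ℕ → Gm m → ℂ) (n : ℕ) (x : Gm m) : ℂ :=
  ((∑ k ∈ Finset.range n, q k : ℝ) : ℂ)⁻¹ *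
    ∑ k ∈ Finset.range n, (q (n - (k + 1)) : ℂ) * S m μ f (k + 1) x

/-- The martingale maximal function `f* = sup_n |f^(n)|`. -/
def mstar (f : ℕ → Gm m → ℂ) (x : Gm m) : ℝ≥0∞ := ⨆ n, (‖f n x‖₊ : ℝ≥0∞)

/-- The `L_p`-type quasi-norm `(∫ g^p dμ)^{1/p}` of an `ℝ≥0∞`-valued function. -/
def eLp (μ : Measure (Gm m)) (p : ℝ) (g : Gm m → ℝ≥0∞) : ℝ≥0∞ :=
  (∫⁻ x, g x ^ p ∂μ) ^ (1 / p)

/-- Membership in the martingale Hardy space `H_p`: `‖f‖_{H_p} = ‖f*‖_{L_p} < ∞`. -/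
def MemHp (μ : Measure (Gm m)) (p : ℝ) (f : ℕ → Gm m → ℂ) : Prop :=
  eLp m μ p (mstar m f) ≠ ⊤

/-- The weak-`L_p` quasi-norm `sup_{t>0} t · μ(g > t)^{1/p}`. -/
def wLp (μ : Measure (Gm m)) (p : ℝ) (g : Gm m → ℝ≥0∞) : ℝ≥0∞ :=
  ⨆ t : ℝ≥0, (t : ℝ≥0∞) * μ {x | (t : ℝ≥0∞) < g x} ^ (1 / p)

end Vilenkin

namespace Vilenkin

variable {m : ℕ → ℕ}

/-! ### The generalized number system -/

lemma M_pos (hm : ∀ k, 2 ≤ m k) (k : ℕ) : 0 < M m k := by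
  induction k with
  | zero => simp [M]
  | succ k ih => exact Nat.mul_pos (by linarith [hm k]) ih

lemma two_pow_le_M (hm : ∀ k, 2 ≤ m k) (k : ℕ) : 2 ^ k ≤ M m k := by
  induction k with
  | zero => simp [M]
  | succ k ih => rw [pow_succ, mul_comm]; exact Nat.mul_le_mul (hm k) ih

lemma lt_M_succ (hm : ∀ k, 2 ≤ m k) (n : ℕ) : n < M m (n + 1) :=
  (Nat.lt_two_pow_self.trans_le (Nat.pow_le_pow_right two_pos n.le_succ)).trans_le
    (two_pow_le_M hm (n + 1))

lemma M_dvd_M {j k : ℕ} (h : j ≤ k) : M m j ∣ M m k := by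
  induction k, h using Nat.le_induction with
  | base => exact dvd_rfl
  | succ k _ ih => exact ih.trans (Dvd.intro_left _ rfl)

lemma M_mono (hm : ∀ k, 2 ≤ m k) {j k : ℕ} (h : j ≤ k) : M m j ≤ M m k :=
  Nat.le_of_dvd (M_pos hm k) (M_dvd_M h)

lemma digit_eq_zero_of_lt (hm : ∀ k, 2 ≤ m k) {n j k : ℕ} (hn : n < M m j) (hjk : j ≤ k) :
    digit m n k = 0 := by
  simp [digit, Nat.div_eq_of_lt (hn.trans_le (M_mono hm hjk))]

lemma digit_mul_M_add_of_lt (hm : ∀ k, 2 ≤ m k) (b i : ℕ) {j k : ℕ} (hkj : k < j) :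
    digit m (b * M m j + i) k = digit m i k := by
  obtain ⟨c, hc⟩ := M_dvd_M (m := m) (Nat.succ_le_of_lt hkj)
  have : b * M m j + i = i + M m k * (m k * (b * c)) := by
    rw [hc, Nat.succ_eq_add_one, M]; ring
  rw [digit, digit, this, Nat.add_mul_div_left _ _ (M_pos hm k), Nat.add_mul_mod_self_left]

lemma digit_mul_M_add_of_le (hm : ∀ k, 2 ≤ m k) (b : ℕ) {i j k : ℕ} (hi : i < M m j)
    (hjk : j ≤ k) : digit m (b * M m j + i) k = digit m (b * M m j) k := by
  obtain ⟨c, hc⟩ := M_dvd_M (m := m) hjk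
  rw [digit, digit, hc, ← Nat.div_div_eq_div_mul, ← Nat.div_div_eq_div_mul,
    mul_comm b, Nat.mul_add_div (M_pos hm j), Nat.div_eq_of_lt hi, add_zero,
    Nat.mul_div_cancel_left _ (M_pos hm j)]

lemma digit_mul_M_add (hm : ∀ k, 2 ≤ m k) (b : ℕ) {i j : ℕ} (hi : i < M m j) (k : ℕ) :
    digit m (b * M m j + i) k = digit m (b * M m j) k + digit m i k := by
  rcases lt_or_ge k j with h | h
  · have h0 := digit_mul_M_add_of_lt hm b 0 h
    rw [add_zero] at h0
    rw [digit_mul_M_add_of_lt hm b i h, h0]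
    simp [digit]
  · rw [digit_mul_M_add_of_le hm b hi h, digit_eq_zero_of_lt hm hi h, add_zero]

/-! ### Vilenkin functions and the kernel of the `M_j`-th partial sum -/

lemma vil_eq_prod (hm : ∀ k, 2 ≤ m k) {n N : ℕ} (hn : n < M m N) (x : Gm m) :
    vil m n x = ∏ k ∈ range N, rad m k x ^ digit m n k := by
  have key : ∀ A B : ℕ, n < M m A → A ≤ B →
      ∏ k ∈ range B, rad m k x ^ digit m n k = ∏ k ∈ range A, rad m k x ^ digit m n k := by
    intro A B hA hAB
    refine (prod_subset (range_mono hAB) fun k _ hk => ?_).symm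
    rw [digit_eq_zero_of_lt hm hA (by simpa using hk), pow_zero]
  rw [vil]
  rcases le_total (n + 1) N with h | h
  · exact (key _ _ (lt_M_succ hm n) h).symm
  · exact key _ _ hn h

lemma vil_mul_M_add (hm : ∀ k, 2 ≤ m k) (b : ℕ) {i j : ℕ} (hi : i < M m j) (x : Gm m) :
    vil m (b * M m j + i) x = vil m (b * M m j) x * vil m i x := by
  have hN := lt_M_succ hm (b * M m j + i)
  rw [vil_eq_prod hm hN, vil_eq_prod hm ((Nat.le_add_right _ _).trans_lt hN),
    vil_eq_prod hm ((Nat.le_add_left _ _).trans_lt hN), ← prod_mul_distrib]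
  exact prod_congr rfl fun k _ => by rw [digit_mul_M_add hm b hi, pow_add]

lemma vil_mul_M (hm : ∀ k, 2 ≤ m k) {s j : ℕ} (hs : s < m j) (x : Gm m) :
    vil m (s * M m j) x = rad m j x ^ s := by
  have hN : s * M m j < M m (j + 1) := Nat.mul_lt_mul_of_pos_right hs (M_pos hm j)
  rw [vil_eq_prod hm hN, prod_range_succ, prod_eq_one, one_mul]
  · rw [digit, Nat.mul_div_cancel _ (M_pos hm j), Nat.mod_eq_of_lt hs]
  · intro k hk
    have h0 := digit_mul_M_add_of_lt hm s 0 (mem_range.1 hk)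
    rw [add_zero] at h0
    rw [h0]
    simp [digit]

lemma rad_eq_pow (k : ℕ) (x : Gm m) :
    rad m k x = Complex.exp (2 * Real.pi * Complex.I / (m k : ℂ)) ^ (x k).val := by
  rw [rad, ← Complex.exp_nat_mul]
  ring_nf

lemma norm_rad (k : ℕ) (x : Gm m) : ‖rad m k x‖ = 1 := by
  have : (2 * Real.pi * Complex.I * ((x k).val : ℂ) / (m k : ℂ))
      = ((2 * Real.pi * (x k).val / m k : ℝ) : ℂ) * Complex.I := by
    push_cast; ring
  rw [rad, this, Complex.norm_exp_ofReal_mul_I]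

lemma norm_vil (n : ℕ) (x : Gm m) : ‖vil m n x‖ = 1 := by
  simp [vil, norm_rad]

lemma vil_congr (hm : ∀ k, 2 ≤ m k) {n N : ℕ} (hn : n < M m N) {x y : Gm m}
    (h : ∀ k < N, x k = y k) : vil m n x = vil m n y := by
  rw [vil_eq_prod hm hn, vil_eq_prod hm hn]
  exact prod_congr rfl fun k hk => by rw [rad, rad, h k (mem_range.1 hk)]

lemma sum_rad_pow_eq_zero (hm : ∀ k, 2 ≤ m k) {j : ℕ} {x t : Gm m} (h : t j ≠ x j) :
    ∑ s ∈ range (m j), (rad m j x * (starRingEnd ℂ) (rad m j t)) ^ s = 0 := by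
  have hm0 : m j ≠ 0 := by have := hm j; omega
  have : NeZero (m j) := ⟨hm0⟩
  have hprim := Complex.isPrimitiveRoot_exp (m j) hm0
  have hpow : ∀ y : Gm m, rad m j y ^ m j = 1 := fun y => by
    rw [rad_eq_pow, pow_right_comm, hprim.pow_eq_one, one_pow]
  have hconj : rad m j t * (starRingEnd ℂ) (rad m j t) = 1 := by
    rw [Complex.mul_conj, Complex.normSq_eq_norm_sq, norm_rad]; norm_num
  have hne : rad m j x * (starRingEnd ℂ) (rad m j t) ≠ 1 := by
    intro hone
    have hxt : rad m j x = rad m j t := by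
      calc rad m j x = (rad m j x * (starRingEnd ℂ) (rad m j t)) * rad m j t := by
            rw [mul_assoc, mul_comm (_ : ℂ) (rad m j t), hconj, mul_one]
        _ = rad m j t := by rw [hone, one_mul]
    rw [rad_eq_pow, rad_eq_pow] at hxt
    exact h (ZMod.val_injective _ (hprim.pow_inj (ZMod.val_lt _) (ZMod.val_lt _) hxt)).symm
  have hgeom := geom_sum_mul (rad m j x * (starRingEnd ℂ) (rad m j t)) (m j)
  rw [mul_pow, ← map_pow, hpow, hpow, map_one, mul_one, sub_self] at hgeom
  exact (mul_eq_zero.1 hgeom).resolve_right (sub_ne_zero.2 hne)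

lemma sum_range_mul_M (g : ℕ → ℂ) (q N : ℕ) :
    ∑ i ∈ range (q * N), g i = ∑ s ∈ range q, ∑ i ∈ range N, g (s * N + i) := by
  induction q with
  | zero => simp
  | succ q ih => rw [add_mul, one_mul, sum_range_add, ih, sum_range_succ]

open Classical in
lemma norm_sum_vil_mul_conj_le (hm : ∀ k, 2 ≤ m k) (j : ℕ) (x t : Gm m) :
    ‖∑ i ∈ range (M m j), vil m i x * (starRingEnd ℂ) (vil m i t)‖
      ≤ if t ∈ cylAt m j x then (M m j : ℝ) else 0 := by
  have hrec : ∀ j, ∑ i ∈ range (M m (j + 1)), vil m i x * (starRingEnd ℂ) (vil m i t)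
      = (∑ s ∈ range (m j), (rad m j x * (starRingEnd ℂ) (rad m j t)) ^ s) *
        ∑ i ∈ range (M m j), vil m i x * (starRingEnd ℂ) (vil m i t) := by
    intro j
    rw [M, sum_range_mul_M, sum_mul]
    refine sum_congr rfl fun s hs => ?_
    rw [mul_sum]
    refine sum_congr rfl fun i hi => ?_
    rw [vil_mul_M_add hm s (mem_range.1 hi), vil_mul_M_add hm s (mem_range.1 hi),
      vil_mul_M hm (mem_range.1 hs), vil_mul_M hm (mem_range.1 hs), mul_pow]
    simp only [map_mul, map_pow]
    ring
  split_ifs with h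
  · refine (norm_sum_le _ _).trans ?_
    simp [norm_vil]
  · simp only [cylAt, Set.mem_ofPred_eq, not_forall] at h
    obtain ⟨k, hk, hne⟩ := h
    suffices ∑ i ∈ range (M m j), vil m i x * (starRingEnd ℂ) (vil m i t) = 0 by simp [this]
    induction j, Nat.succ_le_of_lt hk using Nat.le_induction with
    | base => rw [Nat.succ_eq_add_one, hrec, sum_rad_pow_eq_zero hm hne, zero_mul]
    | succ j hkj ih => rw [hrec, ih hkj, mul_zero]

/-! ### Measurability and cylinders -/

instance (n : ℕ) : DiscreteMeasurableSpace (ZMod n) := ⟨fun _ => trivial⟩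

lemma measurable_of_dependsOn (hm : ∀ k, 2 ≤ m k) {β : Type*} [MeasurableSpace β] {n : ℕ}
    {φ : Gm m → β} (h : ∀ x y : Gm m, (∀ k < n, x k = y k) → φ x = φ y) : Measurable φ := by
  have : ∀ k, NeZero (m k) := fun k => ⟨by have := hm k; omega⟩
  let e : (∀ k : Fin n, ZMod (m k)) → Gm m := fun y k => if hk : k < n then y ⟨k, hk⟩ else 0
  have hφ : φ = (fun y => φ (e y)) ∘ fun (x : Gm m) (k : Fin n) => x k := by
    funext x
    exact h _ _ fun k hk => by simp [e, hk]
  rw [hφ]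
  exact (measurable_of_countable _).comp (measurable_pi_lambda _ fun k => measurable_pi_apply _)

lemma measurableSet_setOf_mem_cylAt (hm : ∀ k, 2 ≤ m k) (n : ℕ) :
    MeasurableSet {p : Gm m × Gm m | p.2 ∈ cylAt m n p.1} := by
  have : ∀ k, NeZero (m k) := fun k => ⟨by have := hm k; omega⟩
  have h : {p : Gm m × Gm m | p.2 ∈ cylAt m n p.1}
      = ⋂ k : Fin n, {p : Gm m × Gm m | p.2 k = p.1 k} := by
    ext p
    simp [cylAt, Fin.forall_iff]
  rw [h]
  exact MeasurableSet.iInter fun k => measurableSet_eq_fun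
    ((measurable_pi_apply _).comp measurable_snd) ((measurable_pi_apply _).comp measurable_fst)

lemma mem_cylAt_comm {n : ℕ} {x t : Gm m} : t ∈ cylAt m n x ↔ x ∈ cylAt m n t :=
  forall₂_congr fun _ _ => eq_comm

lemma measurableSet_cylAt (hm : ∀ k, 2 ≤ m k) (n : ℕ) (x : Gm m) :
    MeasurableSet (cylAt m n x) :=
  (measurableSet_setOf_mem_cylAt hm n).preimage measurable_prodMk_left

lemma cylAt_congr {n : ℕ} {x y : Gm m} (h : ∀ k < n, x k = y k) :
    cylAt m n x = cylAt m n y := by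
  ext t
  exact forall₂_congr fun k hk => by rw [h k hk]

lemma IsHaar.isProbabilityMeasure {μ : Measure (Gm m)} (hμ : IsHaar m μ) :
    IsProbabilityMeasure μ := by
  refine ⟨?_⟩
  have h : cylAt m 0 (0 : Gm m) = Set.univ := by ext; simp [cylAt]
  rw [← h, hμ]
  simp [M]

/-! ### Averages over cylinders -/

/-- The average of `g` over the cylinder of length `j` around `x`, that is, the conditional
expectation of `g` with respect to `ℱ_j`. -/
def avg (μ : Measure (Gm m)) (j : ℕ) (g : Gm m → ℝ≥0∞) (x : Gm m) : ℝ≥0∞ :=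
  M m j * ∫⁻ t in cylAt m j x, g t ∂μ

lemma measurable_avg (hm : ∀ k, 2 ≤ m k) (μ : Measure (Gm m)) (j : ℕ) (g : Gm m → ℝ≥0∞) :
    Measurable (avg μ j g) :=
  measurable_of_dependsOn hm (n := j) fun x y h => by rw [avg, avg, cylAt_congr h]

lemma avg_sum {ι : Type*} (μ : Measure (Gm m)) (j : ℕ) (s : Finset ι)
    {g : ι → Gm m → ℝ≥0∞} (hg : ∀ i, Measurable (g i)) (x : Gm m) :
    avg μ j (fun t => ∑ i ∈ s, g i t) x = ∑ i ∈ s, avg μ j (g i) x := by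
  simp only [avg]
  rw [lintegral_finsetSum _ fun i _ => hg i, mul_sum]

lemma IsHaar.M_mul_measure_cylAt (hm : ∀ k, 2 ≤ m k) {μ : Measure (Gm m)} (hμ : IsHaar m μ)
    (j : ℕ) (x : Gm m) : (M m j : ℝ≥0∞) * μ (cylAt m j x) = 1 := by
  rw [hμ]
  exact ENNReal.mul_inv_cancel (by exact_mod_cast (M_pos hm j).ne') (ENNReal.natCast_ne_top _)

lemma avg_eq_self (hm : ∀ k, 2 ≤ m k) {μ : Measure (Gm m)} (hμ : IsHaar m μ) {i j : ℕ}
    (hij : i ≤ j) {g : Gm m → ℝ≥0∞} (h : ∀ x y : Gm m, (∀ k < i, x k = y k) → g x = g y)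
    (x : Gm m) : avg μ j g x = g x := by
  rw [avg, setLIntegral_congr_fun (g := fun _ => g x) (measurableSet_cylAt hm j x)
    fun t ht => h _ _ fun k hk => ht k (hk.trans_le hij), setLIntegral_const, mul_left_comm,
    hμ.M_mul_measure_cylAt hm, mul_one]

lemma lintegral_avg (hm : ∀ k, 2 ≤ m k) {μ : Measure (Gm m)} (hμ : IsHaar m μ) (j : ℕ)
    {g : Gm m → ℝ≥0∞} (hg : Measurable g) : ∫⁻ x, avg μ j g x ∂μ = ∫⁻ x, g x ∂μ := by
  have := hμ.isProbabilityMeasure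
  have hind : ∀ x t : Gm m, (cylAt m j x).indicator g t
      = (cylAt m j t).indicator (fun _ => g t) x := by
    intro x t
    by_cases h : t ∈ cylAt m j x
    · rw [Set.indicator_of_mem h, Set.indicator_of_mem (mem_cylAt_comm.1 h)]
    · rw [Set.indicator_of_notMem h, Set.indicator_of_notMem fun h' => h (mem_cylAt_comm.1 h')]
  have hmeas : Measurable (Function.uncurry fun x t : Gm m => (cylAt m j x).indicator g t) :=
    (hg.comp measurable_snd).indicator (measurableSet_setOf_mem_cylAt hm j)
  calc ∫⁻ x, avg μ j g x ∂μ
      = M m j * ∫⁻ x, ∫⁻ t, (cylAt m j x).indicator g t ∂μ ∂μ := by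
        simp only [avg]
        rw [lintegral_const_mul' _ _ (ENNReal.natCast_ne_top _)]
        simp only [lintegral_indicator (measurableSet_cylAt hm j _)]
    _ = M m j * ∫⁻ t, ∫⁻ x, (cylAt m j t).indicator (fun _ => g t) x ∂μ ∂μ := by
        rw [lintegral_lintegral_swap hmeas.aemeasurable]
        simp only [hind]
    _ = ∫⁻ x, g x ∂μ := by
        rw [← lintegral_const_mul' _ _ (ENNReal.natCast_ne_top _)]
        refine lintegral_congr fun t => ?_
        rw [lintegral_indicator (measurableSet_cylAt hm j _), setLIntegral_const, mul_left_comm,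
          hμ.M_mul_measure_cylAt hm, mul_one]

/-! ### Partial sums are controlled by averages -/

lemma measurable_vil (hm : ∀ k, 2 ≤ m k) (i : ℕ) : Measurable (vil m i) :=
  measurable_of_dependsOn hm fun _ _ h => vil_congr hm (lt_M_succ hm i) h

lemma integrable_mul_conj_vil (hm : ∀ k, 2 ≤ m k) {μ : Measure (Gm m)} {g : Gm m → ℂ}
    (hg : Integrable g μ) (i : ℕ) :
    Integrable (fun t => g t * (starRingEnd ℂ) (vil m i t)) μ :=
  hg.mul_bdd (c := 1)
    (continuous_star.measurable.comp (measurable_vil hm i)).aestronglyMeasurable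
    (.of_forall fun t => by simp [norm_vil])

lemma IsMartingale.integral_mul_eq (hm : ∀ k, 2 ≤ m k) {μ : Measure (Gm m)} (hμ : IsHaar m μ)
    {f : ℕ → Gm m → ℂ} (hf : IsMartingale m μ f) {n N : ℕ} (hnN : n ≤ N) {φ : Gm m → ℂ}
    {C : ℝ} (hφ : ∀ x, ‖φ x‖ ≤ C) (hdep : ∀ x y : Gm m, (∀ k < n, x k = y k) → φ x = φ y) :
    ∫ x, f n x * φ x ∂μ = ∫ x, f N x * φ x ∂μ := by
  have := hμ.isProbabilityMeasure
  have hswap : ∀ x t : Gm m, (cylAt m n x).indicator (fun t => f N t * φ x) t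
      = (cylAt m n t).indicator (fun _ => f N t * φ t) x := by
    intro x t
    by_cases h : t ∈ cylAt m n x
    · rw [Set.indicator_of_mem h, Set.indicator_of_mem (mem_cylAt_comm.1 h), hdep t x h]
    · rw [Set.indicator_of_notMem h, Set.indicator_of_notMem fun h' => h (mem_cylAt_comm.1 h')]
  have hint : Integrable
      (Function.uncurry fun x t : Gm m => (cylAt m n x).indicator (fun t => f N t * φ x) t)
      (μ.prod μ) := by
    have h1 : Integrable (fun p : Gm m × Gm m => f N p.2 * φ p.1) (μ.prod μ) :=
      ((hf.integrable N).comp_snd μ).mul_bdd (c := C)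
        ((measurable_of_dependsOn hm hdep).comp measurable_fst).aestronglyMeasurable
        (.of_forall fun p => hφ p.1)
    exact h1.indicator (measurableSet_setOf_mem_cylAt hm n)
  have hM : (M m n : ℂ) ≠ 0 := by exact_mod_cast (M_pos hm n).ne'
  have hreal : ∀ t, μ.real (cylAt m n t) = (M m n : ℝ)⁻¹ := fun t => by
    simp [Measure.real, hμ n t]
  calc ∫ x, f n x * φ x ∂μ
      = ∫ x, M m n * ∫ t, (cylAt m n x).indicator (fun t => f N t * φ x) t ∂μ ∂μ := by
        refine integral_congr_ae (.of_forall fun x => ?_)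
        simp only
        rw [hf.mart n N hnN x, integral_indicator (measurableSet_cylAt hm n x),
          integral_mul_const, mul_assoc]
    _ = M m n * ∫ t, ∫ x, (cylAt m n t).indicator (fun _ => f N t * φ t) x ∂μ ∂μ := by
        rw [integral_const_mul, integral_integral_swap hint]
        simp only [hswap]
    _ = ∫ x, f N x * φ x ∂μ := by
        rw [← integral_const_mul]
        refine integral_congr_ae (.of_forall fun t => ?_)
        simp only
        rw [integral_indicator (measurableSet_cylAt hm n t), setIntegral_const, hreal,
          Complex.real_smul]
        push_cast
        rw [mul_inv_cancel_left₀ hM]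

lemma IsMartingale.coeff_eq (hm : ∀ k, 2 ≤ m k) {μ : Measure (Gm m)} (hμ : IsHaar m μ)
    {f : ℕ → Gm m → ℂ} (hf : IsMartingale m μ f) {i N : ℕ} (hi : i < M m N) :
    coeff m μ f i = ∫ x, f N x * (starRingEnd ℂ) (vil m i x) ∂μ := by
  have key : ∀ A B : ℕ, i < M m A → A ≤ B →
      ∫ x, f A x * (starRingEnd ℂ) (vil m i x) ∂μ
        = ∫ x, f B x * (starRingEnd ℂ) (vil m i x) ∂μ := fun A B hA hAB =>
    hf.integral_mul_eq hm hμ hAB (φ := fun x => (starRingEnd ℂ) (vil m i x)) (C := 1)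
      (fun x => by simp [norm_vil]) fun x y h => by rw [vil_congr hm hA h]
  rw [coeff]
  rcases le_total (i + 1) N with h | h
  · exact key _ _ (lt_M_succ hm i) h
  · exact (key _ _ hi h).symm

lemma enorm_sum_block_le (hm : ∀ k, 2 ≤ m k) {μ : Measure (Gm m)} {g : Gm m → ℂ}
    (hg : Integrable g μ) (b j : ℕ) (x : Gm m) :
    ‖∑ i ∈ range (M m j), (∫ t, g t * (starRingEnd ℂ) (vil m (b * M m j + i) t) ∂μ) *
      vil m (b * M m j + i) x‖ₑ ≤ avg μ j (fun t => ‖g t‖ₑ) x := by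
  classical
  simp only [← integral_mul_const]
  rw [← integral_finsetSum _ fun i _ => (integrable_mul_conj_vil hm hg _).mul_const _, avg,
    ← lintegral_const_mul' _ _ (ENNReal.natCast_ne_top _),
    ← lintegral_indicator (measurableSet_cylAt hm j x)]
  refine (enorm_integral_le_lintegral_enorm _).trans (lintegral_mono fun t => ?_)
  have hfac : ∑ i ∈ range (M m j), g t * (starRingEnd ℂ) (vil m (b * M m j + i) t) *
        vil m (b * M m j + i) x
      = g t * (starRingEnd ℂ) (vil m (b * M m j) t) * vil m (b * M m j) x *
        ∑ i ∈ range (M m j), vil m i x * (starRingEnd ℂ) (vil m i t) := by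
    rw [mul_sum]
    refine sum_congr rfl fun i hi => ?_
    rw [vil_mul_M_add hm b (mem_range.1 hi), vil_mul_M_add hm b (mem_range.1 hi), map_mul]
    ring
  have hker := norm_sum_vil_mul_conj_le hm j x t
  rw [hfac, enorm_mul, enorm_mul, enorm_mul]
  have h1 : ∀ n (y : Gm m), ‖vil m n y‖ₑ = 1 := fun n y => by
    rw [← ofReal_norm, norm_vil, ENNReal.ofReal_one]
  have h2 : ∀ z : ℂ, ‖(starRingEnd ℂ) z‖ₑ = ‖z‖ₑ := fun z => by
    rw [← ofReal_norm, RCLike.norm_conj, ofReal_norm]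
  rw [h2, h1, h1, mul_one, mul_one, mul_comm, ← ofReal_norm]
  by_cases h : t ∈ cylAt m j x
  · rw [if_pos h] at hker
    rw [Set.indicator_of_mem h, ← ENNReal.ofReal_natCast]
    gcongr
  · rw [if_neg h] at hker
    rw [Set.indicator_of_notMem h, ENNReal.ofReal_of_nonpos hker, zero_mul]

lemma enorm_sum_partial_le (hm : ∀ k, 2 ≤ m k) {lam : ℕ} (hlam : ∀ k, m k ≤ lam)
    {μ : Measure (Gm m)} {g : Gm m → ℂ} (hg : Integrable g μ) (x : Gm m) (N : ℕ) :
    ∀ b n : ℕ, n < M m N →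
    ‖∑ i ∈ range n, (∫ t, g t * (starRingEnd ℂ) (vil m (b * M m N + i) t) ∂μ) *
      vil m (b * M m N + i) x‖ₑ
      ≤ lam * ∑ j ∈ range N, avg μ j (fun t => ‖g t‖ₑ) x := by
  induction N with
  | zero => intro b n hn; simp [Nat.lt_one_iff.1 hn]
  | succ N ih =>
    intro b n hn
    set P : ℕ → ℂ := fun i => (∫ t, g t * (starRingEnd ℂ) (vil m i t) ∂μ) * vil m i x
    have hq : n / M m N < m N := Nat.div_lt_of_lt_mul (by rwa [mul_comm])
    have hr : n % M m N < M m N := Nat.mod_lt _ (M_pos hm N)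
    have hidx : ∀ s i, b * M m (N + 1) + (s * M m N + i) = (b * m N + s) * M m N + i := by
      intro s i; rw [M]; ring
    change ‖∑ i ∈ range n, P (b * M m (N + 1) + i)‖ₑ ≤ _
    rw [← Nat.div_add_mod' n (M m N), sum_range_add, sum_range_mul_M]
    simp only [hidx]
    rw [sum_range_succ, mul_add, add_comm]
    refine (enorm_add_le _ _).trans (add_le_add (ih _ _ hr) ?_)
    refine (enorm_sum_le _ _).trans ?_
    refine (sum_le_sum fun s _ => enorm_sum_block_le hm hg _ N x).trans ?_
    rw [sum_const, card_range, nsmul_eq_mul]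
    gcongr
    exact hq.le.trans (hlam N)

lemma IsMartingale.enorm_S_le (hm : ∀ k, 2 ≤ m k) {lam : ℕ} (hlam : ∀ k, m k ≤ lam)
    {μ : Measure (Gm m)} (hμ : IsHaar m μ) {f : ℕ → Gm m → ℂ} (hf : IsMartingale m μ f)
    {n N : ℕ} (hn : n < M m N) (x : Gm m) :
    ‖S m μ f n x‖ₑ ≤ lam * ∑ j ∈ range N, avg μ j (fun t => ‖f N t‖ₑ) x := by
  have h := enorm_sum_partial_le hm hlam (hf.integrable N) x N 0 n hn
  simp only [zero_mul, zero_add] at h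
  rwa [S, sum_congr rfl fun i hi => by rw [hf.coeff_eq hm hμ ((mem_range.1 hi).trans hn)]]

/-! ### A maximal inequality for adapted sequences -/

/-- The increments of the running maximum `sup_{l ≤ i} |f^(l)|`. -/
def maxIncr (f : ℕ → Gm m → ℂ) (i : ℕ) (x : Gm m) : ℝ≥0∞ :=
  partialSups (fun l => ‖f l x‖ₑ) i - if i = 0 then 0 else partialSups (fun l => ‖f l x‖ₑ) (i - 1)

lemma sum_maxIncr (f : ℕ → Gm m → ℂ) (N : ℕ) (x : Gm m) :
    ∑ i ∈ range (N + 1), maxIncr f i x = partialSups (fun l => ‖f l x‖ₑ) N := by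
  induction N with
  | zero => simp [maxIncr]
  | succ N ih =>
    rw [sum_range_succ, ih, maxIncr, if_neg N.succ_ne_zero, Nat.add_sub_cancel]
    exact add_tsub_cancel_of_le ((partialSups _).monotone N.le_succ)

lemma tsum_maxIncr_le (f : ℕ → Gm m → ℂ) (x : Gm m) :
    ∑' i, maxIncr f i x ≤ mstar m f x := by
  refine ENNReal.tsum_le_of_sum_range_le fun N => ?_
  refine (sum_le_sum_of_subset (range_mono N.le_succ)).trans ?_
  rw [sum_maxIncr]
  exact partialSups_le _ _ _ fun l _ => le_iSup (fun n => (‖f n x‖₊ : ℝ≥0∞)) l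

lemma IsMartingale.maxIncr_congr {μ : Measure (Gm m)} {f : ℕ → Gm m → ℂ}
    (hf : IsMartingale m μ f) (i : ℕ) {x y : Gm m} (h : ∀ k < i, x k = y k) :
    maxIncr f i x = maxIncr f i y := by
  have hsup : ∀ j ≤ i, partialSups (fun l => ‖f l x‖ₑ) j = partialSups (fun l => ‖f l y‖ₑ) j := by
    intro j hj
    simp only [partialSups_apply]
    refine sup'_congr _ rfl fun l hl => ?_
    rw [hf.adapted l x y fun k hk => h k (hk.trans_le ((mem_Iic.1 hl).trans hj))]
  rw [maxIncr, maxIncr, hsup i le_rfl, hsup (i - 1) (Nat.sub_le _ _)]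

lemma IsMartingale.measurable_maxIncr (hm : ∀ k, 2 ≤ m k) {μ : Measure (Gm m)}
    {f : ℕ → Gm m → ℂ} (hf : IsMartingale m μ f) (i : ℕ) : Measurable (maxIncr f i) :=
  measurable_of_dependsOn hm fun _ _ h => hf.maxIncr_congr i h

/-- A majorant of the means `N⁻¹ ∑_{j < N} E[|f^(N)| | ℱ_j]` that does not depend on `N`. -/
def majorant (μ : Measure (Gm m)) (f : ℕ → Gm m → ℂ) (x : Gm m) : ℝ≥0∞ :=
  ∑' i : ℕ, ((i : ℝ≥0∞)⁻¹ * ∑ j ∈ range i, avg μ j (maxIncr f i) x + maxIncr f i x)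

lemma IsMartingale.sum_avg_le (hm : ∀ k, 2 ≤ m k) {μ : Measure (Gm m)} (hμ : IsHaar m μ)
    {f : ℕ → Gm m → ℂ} (hf : IsMartingale m μ f) (N : ℕ) (x : Gm m) :
    ∑ j ∈ range N, avg μ j (fun t => ‖f N t‖ₑ) x ≤ N * majorant μ f x := by
  have hterm : ∀ i ∈ range (N + 1), ∑ j ∈ range N, avg μ j (maxIncr f i) x
      ≤ N * ((i : ℝ≥0∞)⁻¹ * ∑ j ∈ range i, avg μ j (maxIncr f i) x + maxIncr f i x) := by
    intro i hi
    have hiN : i ≤ N := Nat.lt_succ_iff.1 (mem_range.1 hi)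
    rw [← sum_range_add_sum_Ico _ hiN, mul_add, ← mul_assoc]
    refine add_le_add ?_ ?_
    · rcases Nat.eq_zero_or_pos i with rfl | hi0
      · simp
      · refine le_mul_of_one_le_left' ?_
        rw [← div_eq_mul_inv, ENNReal.le_div_iff_mul_le (.inl (by exact_mod_cast hi0.ne'))
          (.inl (ENNReal.natCast_ne_top _)), one_mul]
        exact_mod_cast hiN
    · rw [sum_congr rfl fun j hj => avg_eq_self hm hμ (mem_Ico.1 hj).1
        (fun _ _ h => hf.maxIncr_congr i h) x, sum_const, nsmul_eq_mul]
      gcongr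
      simp
  calc ∑ j ∈ range N, avg μ j (fun t => ‖f N t‖ₑ) x
      ≤ ∑ j ∈ range N, avg μ j (fun t => ∑ i ∈ range (N + 1), maxIncr f i t) x := by
        refine sum_le_sum fun j _ => mul_le_mul_right (lintegral_mono fun t => ?_) _
        rw [sum_maxIncr]
        exact le_partialSups (fun l => ‖f l t‖ₑ) N
    _ = ∑ i ∈ range (N + 1), ∑ j ∈ range N, avg μ j (maxIncr f i) x := by
        simp only [avg_sum μ _ _ (hf.measurable_maxIncr hm)]
        exact sum_comm
    _ ≤ N * majorant μ f x := by
        refine (sum_le_sum hterm).trans ?_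
        rw [← mul_sum]
        exact mul_le_mul_right (ENNReal.sum_le_tsum _) _

lemma IsMartingale.lintegral_majorant_le (hm : ∀ k, 2 ≤ m k) {μ : Measure (Gm m)}
    (hμ : IsHaar m μ) {f : ℕ → Gm m → ℂ} (hf : IsMartingale m μ f) :
    ∫⁻ x, majorant μ f x ∂μ ≤ 2 * ∫⁻ x, mstar m f x ∂μ := by
  have hmeas := hf.measurable_maxIncr hm
  have hsum : ∀ i, Measurable fun x => ∑ j ∈ range i, avg μ j (maxIncr f i) x := fun i =>
    Finset.measurable_fun_sum _ fun j _ => measurable_avg hm μ j _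
  have hterm : ∀ i : ℕ, ∫⁻ x, ((i : ℝ≥0∞)⁻¹ * ∑ j ∈ range i, avg μ j (maxIncr f i) x
      + maxIncr f i x) ∂μ ≤ 2 * ∫⁻ x, maxIncr f i x ∂μ := by
    intro i
    rw [lintegral_add_right _ (hmeas i), lintegral_const_mul _ (hsum i),
      lintegral_finsetSum _ fun j _ => measurable_avg hm μ j _,
      sum_congr rfl fun j _ => lintegral_avg hm hμ j (hmeas i), sum_const, card_range,
      nsmul_eq_mul, ← mul_assoc, two_mul]
    gcongr
    exact mul_le_of_le_one_left' (ENNReal.inv_mul_le_one _)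
  calc ∫⁻ x, majorant μ f x ∂μ
      = ∑' i : ℕ, ∫⁻ x, ((i : ℝ≥0∞)⁻¹ * ∑ j ∈ range i, avg μ j (maxIncr f i) x
          + maxIncr f i x) ∂μ :=
        lintegral_tsum fun i => (((hsum i).const_mul _).add (hmeas i)).aemeasurable
    _ ≤ ∑' i : ℕ, 2 * ∫⁻ x, maxIncr f i x ∂μ := ENNReal.tsum_le_tsum hterm
    _ = 2 * ∫⁻ x, ∑' i, maxIncr f i x ∂μ := by
        rw [ENNReal.tsum_mul_left, lintegral_tsum fun i => (hmeas i).aemeasurable]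
    _ ≤ 2 * ∫⁻ x, mstar m f x ∂μ := by
        gcongr with x
        exact tsum_maxIncr_le f x

lemma natLog_succ_le (n : ℕ) :
    ((Nat.log 2 (n + 1) + 1 : ℕ) : ℝ) ≤ 4 * Real.log ((n : ℝ) + 2) := by
  have h2 : (0.5 : ℝ) ≤ Real.log 2 := by linarith [Real.log_two_gt_d9]
  have h : (2 : ℝ) ^ (Nat.log 2 (n + 1) + 1) ≤ ((n : ℝ) + 2) ^ 2 := by
    have h1 : 2 ^ Nat.log 2 (n + 1) ≤ n + 1 := Nat.pow_log_le_self 2 n.succ_ne_zero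
    have h1' : (2 : ℝ) ^ Nat.log 2 (n + 1) ≤ n + 1 := by exact_mod_cast h1
    rw [pow_succ]
    nlinarith [(Nat.cast_nonneg n : (0 : ℝ) ≤ n)]
  have hlog := Real.log_le_log (by positivity) h
  rw [Real.log_pow, Real.log_pow] at hlog
  have hnn : (0 : ℝ) ≤ ((Nat.log 2 (n + 1) + 1 : ℕ) : ℝ) := Nat.cast_nonneg _
  push_cast at hlog hnn ⊢
  nlinarith

lemma IsMartingale.enorm_S_div_log_le (hm : ∀ k, 2 ≤ m k) {lam : ℕ} (hlam : ∀ k, m k ≤ lam)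
    {μ : Measure (Gm m)} (hμ : IsHaar m μ) {f : ℕ → Gm m → ℂ} (hf : IsMartingale m μ f)
    (n : ℕ) (x : Gm m) :
    ‖S m μ f (n + 1) x‖ₑ / ENNReal.ofReal (Real.log ((n : ℝ) + 2))
      ≤ 4 * lam * majorant μ f x := by
  set N := Nat.log 2 (n + 1) + 1
  have hn : n + 1 < M m N :=
    (Nat.lt_pow_succ_log_self one_lt_two _).trans_le (two_pow_le_M hm N)
  refine ENNReal.div_le_of_le_mul ?_
  have hNlog : (N : ℝ≥0∞) ≤ 4 * ENNReal.ofReal (Real.log ((n : ℝ) + 2)) := by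
    rw [← ENNReal.ofReal_natCast]
    refine (ENNReal.ofReal_le_ofReal (natLog_succ_le n)).trans_eq ?_
    rw [ENNReal.ofReal_mul (by norm_num)]
    norm_num
  calc ‖S m μ f (n + 1) x‖ₑ
      ≤ lam * (N * majorant μ f x) :=
        (hf.enorm_S_le hm hlam hμ hn x).trans (mul_le_mul_right (hf.sum_avg_le hm hμ N x) _)
    _ ≤ lam * (4 * ENNReal.ofReal (Real.log ((n : ℝ) + 2)) * majorant μ f x) := by gcongr
    _ = 4 * lam * majorant μ f x * ENNReal.ofReal (Real.log ((n : ℝ) + 2)) := by ring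

end Vilenkin

/-- there is `c > 0` (depending only on `λ = sup m_k`) with
`‖ sup_{n ≥ 1} |S_n f| / log(n+1) ‖_{L_1} ≤ c ‖f‖_{H_1}` for every martingale
`f ∈ H_1`. -/
theorem statement10 (lam : ℕ) :
    ∃ c : ℝ, 0 < c ∧
      ∀ (m : ℕ → ℕ), (∀ k, 2 ≤ m k) → (∀ k, m k ≤ lam) →
      ∀ (μ : Measure (Gm m)), Vilenkin.IsHaar m μ →
      ∀ (f : ℕ → Gm m → ℂ), Vilenkin.IsMartingale m μ f → Vilenkin.MemHp m μ 1 f →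
        Vilenkin.eLp m μ 1 (fun x => ⨆ n : ℕ,
            (‖Vilenkin.S m μ f (n + 1) x‖₊ : ℝ≥0∞) /
              ENNReal.ofReal (Real.log ((n : ℝ) + 2))) ≤
          ENNReal.ofReal c * Vilenkin.eLp m μ 1 (Vilenkin.mstar m f) := by
  refine ⟨8 * lam + 1, by positivity, fun m hm hlam μ hμ f hf _ => ?_⟩
  simp only [Vilenkin.eLp, ENNReal.rpow_one, div_one]
  calc ∫⁻ x, ⨆ n : ℕ, (‖Vilenkin.S m μ f (n + 1) x‖₊ : ℝ≥0∞) /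
          ENNReal.ofReal (Real.log ((n : ℝ) + 2)) ∂μ
      ≤ ∫⁻ x, 4 * lam * Vilenkin.majorant μ f x ∂μ :=
        lintegral_mono fun x => iSup_le fun n => hf.enorm_S_div_log_le hm hlam hμ n x
    _ = 4 * lam * ∫⁻ x, Vilenkin.majorant μ f x ∂μ :=
        lintegral_const_mul' _ _ (ENNReal.mul_ne_top (by norm_num) (ENNReal.natCast_ne_top _))
    _ ≤ 4 * lam * (2 * ∫⁻ x, Vilenkin.mstar m f x ∂μ) := by
        gcongr
        exact hf.lintegral_majorant_le hm hμ
    _ = ENNReal.ofReal (8 * lam) * ∫⁻ x, Vilenkin.mstar m f x ∂μ := by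
        rw [ENNReal.ofReal_mul (by norm_num), ENNReal.ofReal_natCast, ← mul_assoc,
          ENNReal.ofReal_ofNat]
        ring
    _ ≤ ENNReal.ofReal (8 * lam + 1) * ∫⁻ x, Vilenkin.mstar m f x ∂μ := by
        gcongr
        linarith
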